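/- Let G be a finite simple undirected graph in which every vertex has degree at least 1, let α ∈ (0,1), and let π_v denote the personalized PageRank vector of source v. Suppose p, r : V → ℝ satisfy π_s[t] = p[t] + Σ_{v ∈ V} r[v] π_v[t] for all t ∈ V. Then for every vertex t, π_s[t] = p[t] + d_t · Σ_{v ∈ V} π_t[v] · (r[v]/d_v). -/

import Mathlib

open Finset

variable {V : Type*} [Fintype V] [DecidableEq V]

/-- The random-walk transition matrix of `G`: `W[u,v] = 1/dᵤ` if `u ~ v`, else `0`. -/
noncomputable def transMat (G : SimpleGraph V) [DecidableRel G.Adj] : Matrix V V ℝ :=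
  fun u v => if G.Adj u v then ((G.degree u : ℝ))⁻¹ else 0

/-- Personalized PageRank: `π_s[t] = α ∑_{k≥0} (1-α)^k (W^k)[s,t]`. -/
noncomputable def ppr (G : SimpleGraph V) [DecidableRel G.Adj] (α : ℝ) (s t : V) : ℝ :=
  α * ∑' k : ℕ, (1 - α) ^ k * ((transMat G) ^ k) s t

/-- The probability that a simple random walk traverses exactly the walk `p`:
the product of `1/dᵤ` over all vertices `u` of `p` except the last. -/
noncomputable def walkProb (G : SimpleGraph V) [DecidableRel G.Adj] {s t : V}
    (p : G.Walk s t) : ℝ :=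
  (p.support.dropLast.map (fun u => ((G.degree u : ℝ))⁻¹)).prod

theorem transMat_pow_rev (G : SimpleGraph V) [DecidableRel G.Adj]
    (hdeg : ∀ v, 0 < G.degree v) (k : ℕ) : ∀ u v,
    (G.degree u : ℝ) * ((transMat G) ^ k) u v = (G.degree v : ℝ) * ((transMat G) ^ k) v u := by
  have hd : ∀ v, (G.degree v : ℝ) ≠ 0 := fun v => by exact_mod_cast (hdeg v).ne'
  have h1 : ∀ u v, (G.degree u : ℝ) * transMat G u v = (G.degree v : ℝ) * transMat G v u := by
    intro u v
    unfold transMat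
    by_cases h : G.Adj u v
    · simp [h, h.symm, hd]
    · have h' : ¬ G.Adj v u := fun h2 => h h2.symm
      simp [h, h']
  induction k with
  | zero =>
    intro u v
    by_cases h : u = v
    · subst h
      rfl
    · simp [h, Ne.symm h]
  | succ k ih =>
    intro u v
    conv_lhs => rw [pow_succ]
    conv_rhs => rw [pow_succ']
    rw [Matrix.mul_apply, Matrix.mul_apply, Finset.mul_sum, Finset.mul_sum]
    refine Finset.sum_congr rfl fun w _ => ?_
    rw [← mul_assoc, ih u w, ← mul_assoc, ← h1 w v]
    ring

theorem ppr_rev (G : SimpleGraph V) [DecidableRel G.Adj]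
    (hdeg : ∀ v, 0 < G.degree v) (α : ℝ) (u v : V) :
    (G.degree u : ℝ) * ppr G α u v = (G.degree v : ℝ) * ppr G α v u := by
  unfold ppr
  simp only [← tsum_mul_left]
  refine tsum_congr fun k => ?_
  linear_combination (α * (1 - α) ^ k) * transMat_pow_rev G hdeg k u v

theorem invariant_rewrite (G : SimpleGraph V) [DecidableRel G.Adj]
    (hdeg : ∀ v, 0 < G.degree v) (α : ℝ) (hα : α ∈ Set.Ioo (0 : ℝ) 1)
    (s : V) (p r : V → ℝ)
    (hinv : ∀ t, ppr G α s t = p t + ∑ v, r v * ppr G α v t) :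
    ∀ t, ppr G α s t
      = p t + (G.degree t : ℝ) * ∑ v, ppr G α t v * (r v / (G.degree v : ℝ)) := by
  intro t
  rw [hinv t, Finset.mul_sum]
  congr 1
  refine Finset.sum_congr rfl fun v _ => ?_
  have hv : (G.degree v : ℝ) ≠ 0 := by exact_mod_cast (hdeg v).ne'
  rw [← mul_assoc, ppr_rev G hdeg α t v]
  field_simp
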